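/- Let Ū and U be n×d real matrices with orthonormal columns such that ŪᵀU is invertible. Let s ∈ ℝ^d, set v = Ūs, w = Uᵀv, v_∥ = UUᵀv and v_⊥ = v − v_∥, and assume v_∥ ≠ 0 and v_⊥ ≠ 0. Then for every θ ∈ ℝ, the GROUSE update U₊(θ) = U + (cos θ · v_∥/‖v_∥‖ + sin θ · v_⊥/‖v_⊥‖ − v_∥/‖v_∥‖) wᵀ/‖w‖ satisfies det(Ūᵀ U₊(θ)) = det(ŪᵀU) · (cos θ + (‖v_⊥‖/‖v_∥‖) sin θ). -/

import Mathlib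

open Matrix

/-- The Euclidean (ℓ²) norm of a vector in `ℝ^k`. -/
noncomputable def l2norm {k : ℕ} (v : Fin k → ℝ) : ℝ := Real.sqrt (∑ i, v i ^ 2)

theorem det_one_add_vecMulVec_eq {d : ℕ} (x y : Fin d → ℝ) :
    (1 + vecMulVec x y).det = 1 + y ⬝ᵥ x := by
  rw [vecMulVec_eq Unit, det_one_add_replicateCol_mul_replicateRow]

theorem l2norm_sq_eq_dotProduct {k : ℕ} (v : Fin k → ℝ) : l2norm v ^ 2 = v ⬝ᵥ v := by
  rw [l2norm, Real.sq_sqrt (Finset.sum_nonneg fun i _ => sq_nonneg _)]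
  simp [dotProduct, sq]

theorem l2norm_ne_zero {k : ℕ} {v : Fin k → ℝ} (hv : v ≠ 0) : l2norm v ≠ 0 := fun h =>
  hv (dotProduct_self_eq_zero.mp (by rw [← l2norm_sq_eq_dotProduct, h]; simp))

theorem dotProduct_mulVec_of_orthonormal {n d : ℕ} {U : Matrix (Fin n) (Fin d) ℝ}
    (hU : Uᵀ * U = 1) (x y : Fin d → ℝ) : (U *ᵥ x) ⬝ᵥ (U *ᵥ y) = x ⬝ᵥ y := by
  rw [← vecMul_transpose, ← dotProduct_mulVec, mulVec_mulVec, hU, one_mulVec]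

theorem l2norm_mulVec_of_orthonormal {n d : ℕ} {U : Matrix (Fin n) (Fin d) ℝ}
    (hU : Uᵀ * U = 1) (x : Fin d → ℝ) : l2norm (U *ᵥ x) = l2norm x := by
  have h := dotProduct_mulVec_of_orthonormal hU x x
  rw [← l2norm_sq_eq_dotProduct, ← l2norm_sq_eq_dotProduct] at h
  exact (sq_eq_sq₀ (Real.sqrt_nonneg _) (Real.sqrt_nonneg _)).mp h

/-- the determinant identity for the full-data GROUSE update:
`det(Ūᵀ U₊(θ)) = det(ŪᵀU) (cos θ + (‖v⊥‖/‖v∥‖) sin θ)`. -/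
theorem grouse_det_update {n d : ℕ}
    (Ubar U : Matrix (Fin n) (Fin d) ℝ)
    (hUbar : Ubarᵀ * Ubar = 1) (hU : Uᵀ * U = 1)
    (hinv : IsUnit (Ubarᵀ * U))
    (s : Fin d → ℝ)
    (v : Fin n → ℝ) (hv : v = Ubar.mulVec s)
    (w : Fin d → ℝ) (hw : w = Uᵀ.mulVec v)
    (vpar : Fin n → ℝ) (hvpar : vpar = (U * Uᵀ).mulVec v)
    (vperp : Fin n → ℝ) (hvperp : vperp = v - vpar)
    (hpar0 : vpar ≠ 0) (hperp0 : vperp ≠ 0)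
    (θ : ℝ)
    (Uplus : Matrix (Fin n) (Fin d) ℝ)
    (hUplus : Uplus = U + Matrix.vecMulVec
      (fun i => Real.cos θ * (vpar i / l2norm vpar) + Real.sin θ * (vperp i / l2norm vperp)
        - vpar i / l2norm vpar)
      (fun j => w j / l2norm w)) :
    (Ubarᵀ * Uplus).det
      = (Ubarᵀ * U).det * (Real.cos θ + (l2norm vperp / l2norm vpar) * Real.sin θ) := by
  have hpar : vpar = U *ᵥ w := by rw [hvpar, hw, mulVec_mulVec]
  have hvw : v ⬝ᵥ (U *ᵥ w) = w ⬝ᵥ w := by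
    rw [dotProduct_mulVec, ← mulVec_transpose, ← hw]
  have hww : l2norm vpar = l2norm w := by rw [hpar, l2norm_mulVec_of_orthonormal hU]
  have hp : l2norm w ≠ 0 := hww ▸ l2norm_ne_zero hpar0
  have hq : l2norm vperp ≠ 0 := l2norm_ne_zero hperp0
  have hss : s ⬝ᵥ s = v ⬝ᵥ v := by rw [hv, dotProduct_mulVec_of_orthonormal hUbar]
  have hqq : l2norm vperp ^ 2 = v ⬝ᵥ v - w ⬝ᵥ w := by
    rw [l2norm_sq_eq_dotProduct, hvperp, hpar, sub_dotProduct, dotProduct_sub, dotProduct_sub,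
      dotProduct_mulVec_of_orthonormal hU, dotProduct_comm (U *ᵥ w) v, hvw]
    ring
  have hUv : Ubarᵀ *ᵥ v = s := by rw [hv, mulVec_mulVec, hUbar, one_mulVec]
  have hwA : w = s ᵥ* (Ubarᵀ * U) := by
    rw [hw, hv, ← mulVec_transpose, transpose_mul, transpose_transpose, mulVec_mulVec]
  set A := Ubarᵀ * U with hA
  obtain ⟨z, hz⟩ : ∃ z, A *ᵥ z = s :=
    ⟨A⁻¹ *ᵥ s, by
      rw [mulVec_mulVec, mul_nonsing_inv _ ((isUnit_iff_isUnit_det A).mp hinv), one_mulVec]⟩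
  have hwz : w ⬝ᵥ z = v ⬝ᵥ v := by rw [hwA, ← dotProduct_mulVec, hz, hss]
  have hUw : Ubarᵀ *ᵥ vpar = A *ᵥ w := by rw [hpar, mulVec_mulVec]
  have hfac : Ubarᵀ * Uplus = A * (1 + vecMulVec
      (((Real.cos θ - 1) / l2norm w) • w + (Real.sin θ / l2norm vperp) • (z - w))
      ((l2norm w)⁻¹ • w)) := by
    have hx : (fun i => Real.cos θ * (vpar i / l2norm vpar)
        + Real.sin θ * (vperp i / l2norm vperp) - vpar i / l2norm vpar)
        = ((Real.cos θ - 1) / l2norm w) • vpar + (Real.sin θ / l2norm vperp) • (v - vpar) := by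
      rw [← hvperp, hww]
      ext i
      simp only [Pi.add_apply, Pi.smul_apply, smul_eq_mul]
      ring
    have hy : (fun j => w j / l2norm w) = (l2norm w)⁻¹ • w := by
      ext j
      simp only [Pi.smul_apply, smul_eq_mul]
      ring
    rw [hUplus, hx, hy, Matrix.mul_add, Matrix.mul_add, Matrix.mul_one, mul_vecMulVec,
      mul_vecMulVec]
    simp only [mulVec_add, mulVec_smul, mulVec_sub, hUv, hUw, hz, ← hA]
  have hw2 := l2norm_sq_eq_dotProduct w
  rw [hfac, det_mul, det_one_add_vecMulVec_eq, hww]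
  simp only [smul_dotProduct, dotProduct_add, dotProduct_smul, dotProduct_sub, smul_eq_mul, hwz,
    ← hw2]
  rw [← hw2] at hqq
  field_simp
  linear_combination -(A.det * Real.sin θ) * hqq
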